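/- Fix two disjoint groups g₁ and g₂ with base rates BR₁ ≠ BR₂. Then there exists a groupwise calibrated soft classifier Ŝ such that for every hard post-processor D̂ : [0,1] × 𝒢 → {0,1} with Pr[D̂(BR₁, g₁) = 0] > 0 and Pr[D̂(BR₂, g₂) = 0] > 0, the composed hard classifier Ŷ = D̂∘Ŝ does not equalize NPV across the two groups, i.e., NPV_{Ŷ,g₁} ≠ NPV_{Ŷ,g₂}. -/

import Mathlib

open Finset
open scoped Classical

namespace GroupFairness

noncomputable section

variable {X 𝒢 Ω : Type*} [Fintype X] [Fintype Ω]

/-- The finset of members of group `g`. -/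
def grp (Grp : X → 𝒢) (g : 𝒢) : Finset X :=
  Finset.univ.filter (fun x => Grp x = g)

/-- Expectation of `f x ω` over a uniformly random member `x` of group `g`,
together with internal randomness `ω` distributed according to the weights `w`. -/
def Ex (w : Ω → ℝ) (Grp : X → 𝒢) (g : 𝒢) (f : X → Ω → ℝ) : ℝ :=
  (∑ x ∈ grp Grp g, ∑ ω : Ω, w ω * f x ω) / ((grp Grp g).card : ℝ)

/-- Probability of the event `E x ω` for a uniformly random member of group `g`. -/
def Pr (w : Ω → ℝ) (Grp : X → 𝒢) (g : 𝒢) (E : X → Ω → Prop) : ℝ :=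
  Ex w Grp g (fun x ω => if E x ω then 1 else 0)

/-- Conditional probability of `E` given `F`. -/
def cPr (w : Ω → ℝ) (Grp : X → 𝒢) (g : 𝒢) (E F : X → Ω → Prop) : ℝ :=
  Pr w Grp g (fun x ω => E x ω ∧ F x ω) / Pr w Grp g F

/-- `w` is a probability weighting on the randomness space. -/
def ValidWeights (w : Ω → ℝ) : Prop :=
  (∀ ω, 0 ≤ w ω) ∧ ∑ ω : Ω, w ω = 1

/-- The base rate of group `g`: the probability that a uniformly random member
of `g` has true type `1`. -/
def BaseRate (w : Ω → ℝ) (Grp : X → 𝒢) (Y : X → Bool) (g : 𝒢) : ℝ :=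
  Pr w Grp g (fun x _ => Y x = true)

/-- All scores of the soft classifier lie in `[0,1]`. -/
def IsSoft (S : X → Ω → ℝ) : Prop :=
  ∀ x ω, 0 ≤ S x ω ∧ S x ω ≤ 1

/-- `S` is groupwise calibrated: for every group `g` and score `s` occurring with
positive probability, `Pr[Y = 1 ∣ S = s] = s`. -/
def Calibrated (w : Ω → ℝ) (Grp : X → 𝒢) (Y : X → Bool) (S : X → Ω → ℝ) : Prop :=
  ∀ (g : 𝒢) (s : ℝ), 0 < Pr w Grp g (fun x ω => S x ω = s) →
    cPr w Grp g (fun x _ => Y x = true) (fun x ω => S x ω = s) = s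

/-- The accuracy profile of `S` on group `g`: the pmf of the score `S(X_g)`. -/
def AP (w : Ω → ℝ) (Grp : X → 𝒢) (S : X → Ω → ℝ) (g : 𝒢) (s : ℝ) : ℝ :=
  Pr w Grp g (fun x ω => S x ω = s)

/-- The support of the accuracy profile of `S` on group `g`. -/
def APsupp (w : Ω → ℝ) (Grp : X → 𝒢) (S : X → Ω → ℝ) (g : 𝒢) : Set ℝ :=
  {s | 0 < AP w Grp S g s}

/-- The accuracy profile is *nice*: all groups have the same support. -/
def NiceAP (w : Ω → ℝ) (Grp : X → 𝒢) (S : X → Ω → ℝ) : Prop :=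
  ∀ g g' : 𝒢, APsupp w Grp S g = APsupp w Grp S g'

/-- A (randomized) hard post-processor is described by the probability `q s g` of
outputting `1` on score `s` and group `g`; it is valid if these are probabilities. -/
def ValidPP (q : ℝ → 𝒢 → ℝ) : Prop :=
  ∀ (s : ℝ) (g : 𝒢), 0 ≤ q s g ∧ q s g ≤ 1

/-- Probability that the composed hard classifier `D̂ ∘ Ŝ` outputs `1` on group `g`. -/
def prPos (w : Ω → ℝ) (Grp : X → 𝒢) (S : X → Ω → ℝ) (q : ℝ → 𝒢 → ℝ) (g : 𝒢) : ℝ :=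
  Ex w Grp g (fun x ω => q (S x ω) (Grp x))

/-- Probability that the composed hard classifier `D̂ ∘ Ŝ` outputs `0` on group `g`. -/
def prNeg (w : Ω → ℝ) (Grp : X → 𝒢) (S : X → Ω → ℝ) (q : ℝ → 𝒢 → ℝ) (g : 𝒢) : ℝ :=
  Ex w Grp g (fun x ω => 1 - q (S x ω) (Grp x))

/-- The composed hard classifier is non-trivial on `g`. -/
def NonTrivial (w : Ω → ℝ) (Grp : X → 𝒢) (S : X → Ω → ℝ) (q : ℝ → 𝒢 → ℝ) (g : 𝒢) : Prop :=
  0 < prPos w Grp S q g ∧ 0 < prNeg w Grp S q g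

/-- Positive predictive value `Pr[Y = 1 ∣ Ŷ = 1]` of the composed classifier on `g`. -/
def PPV (w : Ω → ℝ) (Grp : X → 𝒢) (Y : X → Bool) (S : X → Ω → ℝ)
    (q : ℝ → 𝒢 → ℝ) (g : 𝒢) : ℝ :=
  Ex w Grp g (fun x ω => (if Y x then 1 else 0) * q (S x ω) (Grp x)) / prPos w Grp S q g

/-- Negative predictive value `Pr[Y = 0 ∣ Ŷ = 0]` of the composed classifier on `g`. -/
def NPV (w : Ω → ℝ) (Grp : X → 𝒢) (Y : X → Bool) (S : X → Ω → ℝ)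
    (q : ℝ → 𝒢 → ℝ) (g : 𝒢) : ℝ :=
  Ex w Grp g (fun x ω => (if Y x then 0 else 1) * (1 - q (S x ω) (Grp x))) / prNeg w Grp S q g

/-- False positive rate `Pr[Ŷ = 1 ∣ Y = 0]` of the composed classifier on `g`. -/
def FPR (w : Ω → ℝ) (Grp : X → 𝒢) (Y : X → Bool) (S : X → Ω → ℝ)
    (q : ℝ → 𝒢 → ℝ) (g : 𝒢) : ℝ :=
  Ex w Grp g (fun x ω => (if Y x then 0 else 1) * q (S x ω) (Grp x)) /
    Pr w Grp g (fun x _ => Y x = false)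

/-- False negative rate `Pr[Ŷ = 0 ∣ Y = 1]` of the composed classifier on `g`. -/
def FNR (w : Ω → ℝ) (Grp : X → 𝒢) (Y : X → Bool) (S : X → Ω → ℝ)
    (q : ℝ → 𝒢 → ℝ) (g : 𝒢) : ℝ :=
  Ex w Grp g (fun x ω => (if Y x then 1 else 0) * (1 - q (S x ω) (Grp x))) /
    Pr w Grp g (fun x _ => Y x = true)

/-- The threshold post-processor with threshold `τ g` and on-threshold probability
`R g` for group `g`: it outputs `1` with probability `1` above the threshold, `0`
below it, and `1` with probability `R g` at the threshold. -/
def thresholdPP (τ R : 𝒢 → ℝ) : ℝ → 𝒢 → ℝ := fun s g =>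
  if τ g < s then 1 else if s = τ g then R g else 0

theorem Ex_congr (w : Ω → ℝ) (Grp : X → 𝒢) (g : 𝒢) {f f' : X → Ω → ℝ}
    (h : ∀ x, Grp x = g → ∀ ω, f x ω = f' x ω) : Ex w Grp g f = Ex w Grp g f' := by
  unfold Ex
  congr 1
  refine Finset.sum_congr rfl fun x hx => Finset.sum_congr rfl fun ω _ => ?_
  rw [h x (by simpa [grp] using hx) ω]

theorem Ex_mul_const (w : Ω → ℝ) (Grp : X → 𝒢) (g : 𝒢) (f : X → Ω → ℝ) (c : ℝ) :
    Ex w Grp g (fun x ω => f x ω * c) = Ex w Grp g f * c := by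
  simp only [Ex, ← mul_assoc, ← Finset.sum_mul]
  rw [div_mul_eq_mul_div]

theorem Ex_const {w : Ω → ℝ} {Grp : X → 𝒢} {g : 𝒢} (hw : ValidWeights w)
    (hg : (grp Grp g).Nonempty) (c : ℝ) : Ex w Grp g (fun _ _ => c) = c := by
  have hc : ((grp Grp g).card : ℝ) ≠ 0 := by exact_mod_cast hg.card_pos.ne'
  simp only [Ex, ← Finset.sum_mul, hw.2, one_mul, Finset.sum_const, nsmul_eq_mul]
  field_simp

theorem Ex_mono {w : Ω → ℝ} (hw : ValidWeights w) (Grp : X → 𝒢) (g : 𝒢) {f f' : X → Ω → ℝ}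
    (h : ∀ x ω, f x ω ≤ f' x ω) : Ex w Grp g f ≤ Ex w Grp g f' := by
  unfold Ex
  gcongr with x _ ω _
  · exact hw.1 ω
  · exact h x ω

theorem Ex_sub (w : Ω → ℝ) (Grp : X → 𝒢) (g : 𝒢) (f f' : X → Ω → ℝ) :
    Ex w Grp g (fun x ω => f x ω - f' x ω) = Ex w Grp g f - Ex w Grp g f' := by
  simp only [Ex, mul_sub, Finset.sum_sub_distrib, sub_div]

theorem baseRate_mem_Icc {w : Ω → ℝ} {Grp : X → 𝒢} {g : 𝒢} (hw : ValidWeights w)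
    (hg : (grp Grp g).Nonempty) (Y : X → Bool) :
    0 ≤ BaseRate w Grp Y g ∧ BaseRate w Grp Y g ≤ 1 := by
  constructor
  · rw [← Ex_const hw hg 0]
    exact Ex_mono hw Grp g fun x _ => by split_ifs <;> norm_num
  · rw [← Ex_const hw hg 1]
    exact Ex_mono hw Grp g fun x _ => by split_ifs <;> norm_num

/-- The classifier scoring each instance by the base rate of its group is calibrated. -/
theorem calibrated_baseRate {w : Ω → ℝ} {Grp : X → 𝒢} (hw : ValidWeights w)
    (hne : ∀ g : 𝒢, (grp Grp g).Nonempty) (Y : X → Bool) :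
    Calibrated w Grp Y (fun x _ => BaseRate w Grp Y (Grp x)) := by
  intro g s hs
  have hPr : Pr w Grp g (fun x _ => BaseRate w Grp Y (Grp x) = s) =
      if BaseRate w Grp Y g = s then 1 else 0 := by
    rw [← Ex_const hw (hne g) (if BaseRate w Grp Y g = s then 1 else 0)]
    exact Ex_congr w Grp g fun x hx _ => by simp only [hx]
  by_cases h : BaseRate w Grp Y g = s
  · rw [cPr, hPr, if_pos h, div_one, ← h]
    exact Ex_congr w Grp g fun x hx _ => by simp [hx]
  · rw [hPr, if_neg h] at hs
    exact absurd hs (lt_irrefl 0)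

/-- Post-processing the group base rates yields negative predictive value `1 - BR`. -/
theorem NPV_baseRate {w : Ω → ℝ} {Grp : X → 𝒢} {g : 𝒢} (hw : ValidWeights w)
    (hg : (grp Grp g).Nonempty) (Y : X → Bool) {q : ℝ → 𝒢 → ℝ}
    (hq : 0 < 1 - q (BaseRate w Grp Y g) g) :
    NPV w Grp Y (fun x _ => BaseRate w Grp Y (Grp x)) q g = 1 - BaseRate w Grp Y g := by
  have hden : prNeg w Grp (fun x _ => BaseRate w Grp Y (Grp x)) q g =
      1 - q (BaseRate w Grp Y g) g := by
    rw [← Ex_const hw hg (1 - q (BaseRate w Grp Y g) g)]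
    exact Ex_congr w Grp g fun x hx _ => by simp only [hx]
  rw [NPV, hden, div_eq_iff hq.ne']
  have hneg : Ex w Grp g (fun x _ => if Y x then 0 else 1) = 1 - BaseRate w Grp Y g := by
    rw [← Ex_const hw hg 1, BaseRate, Pr, ← Ex_sub, Ex_const hw hg 1]
    exact Ex_congr w Grp g fun x _ _ => by split_ifs <;> norm_num
  rw [← hneg, ← Ex_mul_const]
  exact Ex_congr w Grp g fun x hx _ => by simp only [hx]

/-- For two groups with different base rates there is a groupwise
calibrated soft classifier such that no hard post-processor that outputs `0` with
positive probability on input `(BRᵢ, gᵢ)` for `i = 1, 2` yields a composed classifier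
equalizing NPV across the two groups. -/
theorem exists_calibrated_no_postprocessor_equalizes_NPV
    (w : Ω → ℝ) (Grp : X → 𝒢) (Y : X → Bool)
    (hw : ValidWeights w) (hne : ∀ g : 𝒢, (grp Grp g).Nonempty)
    (g₁ g₂ : 𝒢) (hgg : g₁ ≠ g₂)
    (hBR : BaseRate w Grp Y g₁ ≠ BaseRate w Grp Y g₂) :
    ∃ S : X → Ω → ℝ, IsSoft S ∧ Calibrated w Grp Y S ∧
      ∀ q : ℝ → 𝒢 → ℝ, ValidPP q →
        0 < 1 - q (BaseRate w Grp Y g₁) g₁ →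
        0 < 1 - q (BaseRate w Grp Y g₂) g₂ →
        NPV w Grp Y S q g₁ ≠ NPV w Grp Y S q g₂ := by
  refine ⟨fun x _ => BaseRate w Grp Y (Grp x),
    fun x _ => baseRate_mem_Icc hw (hne (Grp x)) Y, calibrated_baseRate hw hne Y, ?_⟩
  intro q _ h₁ h₂ h
  rw [NPV_baseRate hw (hne g₁) Y h₁, NPV_baseRate hw (hne g₂) Y h₂] at h
  exact hBR (sub_right_injective h)

end

end GroupFairness
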